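/- arXiv:1110.6465 — 2 statements merged into one kernel-verified Lean document; each statement's English description precedes it below -/
import Mathlib

section
/- Let K be a field. For every u ∈ M₂(K), every β = [[a,b],[c,d]] ∈ M₂(K), and every x ∈ K with cx + d ≠ 0, one has P_{adj(β)·u·β}(x) = (cx+d)² · P_u((ax+b)/(cx+d)). -/
open Polynomial

/-- The polynomial `P_u(X) := (1, -X) · u · (X, 1)ᵗ = β + (α-δ)X - γX²`
for `u = [[α,β],[γ,δ]]`. -/
noncomputable def Pu {K : Type} [CommRing K] (u : Matrix (Fin 2) (Fin 2) K) : Polynomial K :=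
  C (u 0 1) + C (u 0 0 - u 1 1) * X - C (u 1 0) * X ^ 2

/-- For every `u, β ∈ M₂(K)` and every `x` with `cx + d ≠ 0` (where `β = [[a,b],[c,d]]`),
one has `P_{adj(β)·u·β}(x) = (cx+d)² · P_u((ax+b)/(cx+d))`. -/
theorem stmt1 (K : Type) [Field K] (u β : Matrix (Fin 2) (Fin 2) K) (x : K)
    (h : β 1 0 * x + β 1 1 ≠ 0) :
    (Pu (β.adjugate * u * β)).eval x =
      (β 1 0 * x + β 1 1) ^ 2 *
        (Pu u).eval ((β 0 0 * x + β 0 1) / (β 1 0 * x + β 1 1)) := by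
  simp only [Pu, Matrix.adjugate_fin_two, Matrix.mul_apply, Fin.sum_univ_two, Matrix.of_apply,
    Matrix.cons_val_zero, Matrix.cons_val_one, Matrix.cons_val', Matrix.cons_val_fin_one,
    eval_add, eval_sub, eval_mul, eval_pow, eval_C, eval_X]
  field_simp
  ring
end

section
/- Let K be a field and L a field extension of K with [L : K] = 2, and let Ψ : L → M₂(K) be a K-algebra homomorphism. Then for every ℓ ∈ L^×, the matrix Ψ(ℓ) is invertible, so L^× acts on the projective line ℙ(K²) by ℓ·[v] := [Ψ(ℓ)·v]. This action is simply transitive: for all nonzero v, w ∈ K² there exists ℓ ∈ L^× and a scalar λ ∈ K^× with Ψ(ℓ)·v = λ·w; and if ℓ, ℓ′ ∈ L^× both carry the line K·v to the line K·w, then ℓ/ℓ′ ∈ K^×. In other words, the quotient group L^×/K^× acts simply transitively on ℙ¹(K). -/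
/-- The orbit map `ℓ ↦ Ψ(ℓ) v` attached to a vector `v`, as a `K`-linear map. -/
def AlgHom.mulVecOrbit {K L n : Type*} [Field K] [Field L] [Algebra K L] [Fintype n]
    [DecidableEq n] (Ψ : L →ₐ[K] Matrix n n K) (v : n → K) : L →ₗ[K] (n → K) where
  toFun ℓ := (Ψ ℓ).mulVec v
  map_add' a b := by rw [map_add, Matrix.add_mulVec]
  map_smul' c a := by rw [map_smul, Matrix.smul_mulVec, RingHom.id_apply]

theorem AlgHom.mulVecOrbit_injective {K L n : Type*} [Field K] [Field L] [Algebra K L]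
    [Fintype n] [DecidableEq n] (Ψ : L →ₐ[K] Matrix n n K) {v : n → K} (hv : v ≠ 0) :
    Function.Injective (Ψ.mulVecOrbit v) := by
  refine (injective_iff_map_eq_zero _).2 fun ℓ h => ?_
  by_contra hℓ
  have h0 : (Ψ ℓ).mulVec v = 0 := h
  apply hv
  rw [← Matrix.one_mulVec v, ← map_one Ψ, ← inv_mul_cancel₀ hℓ, map_mul,
    ← Matrix.mulVec_mulVec, h0, Matrix.mulVec_zero]

/-- Let `L/K` be a quadratic field extension and `Ψ : L → M₂(K)` a `K`-algebra homomorphism.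
Then every `Ψ(ℓ)`, `ℓ ∈ L^×`, is invertible, and the induced action of `L^×/K^×` on
`ℙ¹(K)` is simply transitive. -/
theorem stmt9 (K L : Type) [Field K] [Field L] [Algebra K L]
    (h2 : Module.finrank K L = 2) (Ψ : L →ₐ[K] Matrix (Fin 2) (Fin 2) K) :
    -- Ψ(ℓ) is invertible for ℓ ≠ 0
    (∀ ℓ : L, ℓ ≠ 0 → IsUnit (Ψ ℓ)) ∧
    -- transitivity on lines
    (∀ v w : Fin 2 → K, v ≠ 0 → w ≠ 0 →
      ∃ ℓ : L, ℓ ≠ 0 ∧ ∃ lam : K, lam ≠ 0 ∧ (Ψ ℓ).mulVec v = lam • w) ∧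
    -- simplicity: two elements carrying the line K·v to the line K·w differ by K^×
    (∀ v w : Fin 2 → K, v ≠ 0 → w ≠ 0 →
      ∀ ℓ ℓ' : L, ℓ ≠ 0 → ℓ' ≠ 0 →
        (∃ lam : K, lam ≠ 0 ∧ (Ψ ℓ).mulVec v = lam • w) →
        (∃ lam' : K, lam' ≠ 0 ∧ (Ψ ℓ').mulVec v = lam' • w) →
        ∃ μ : K, μ ≠ 0 ∧ ℓ = algebraMap K L μ * ℓ') := by
  refine ⟨fun ℓ hℓ => (IsUnit.mk0 ℓ hℓ).map Ψ, fun v w hv hw => ?_, ?_⟩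
  · have : FiniteDimensional K L := Module.finite_of_finrank_eq_succ h2
    have hsurj : Function.Surjective (Ψ.mulVecOrbit v) :=
      (LinearMap.injective_iff_surjective_of_finrank_eq_finrank (by simp [h2])).1
        (Ψ.mulVecOrbit_injective hv)
    obtain ⟨ℓ, hℓ⟩ := hsurj w
    refine ⟨ℓ, ?_, 1, one_ne_zero, by rw [one_smul]; exact hℓ⟩
    rintro rfl
    exact hw (hℓ.symm.trans (map_zero _))
  · rintro v w hv - ℓ ℓ' - - ⟨lam, hlam, h⟩ ⟨lam', hlam', h'⟩
    refine ⟨lam / lam', div_ne_zero hlam hlam', ?_⟩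
    rw [← Algebra.smul_def]
    apply Ψ.mulVecOrbit_injective hv
    rw [map_smul]
    change (Ψ ℓ).mulVec v = (lam / lam') • (Ψ ℓ').mulVec v
    rw [h, h', smul_smul, div_mul_cancel₀ _ hlam']
end
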